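/- Let X and Y be measurable spaces, k : X → Y a measurable function, and G : ℱ(X) → [0,1] weakly averaging, affine, and limit-preserving. Then the pushforward functional 𝒯(k)(G) : ℱ(Y) → [0,1] defined by g ↦ G(g ∘ k) is weakly averaging, affine, and limit-preserving, and its associated probability measure S ↦ G(χ_{k⁻¹(S)}) equals the pushforward measure ν_G ∘ k⁻¹ of the probability measure ν_G (where ν_G(T) = G(χ_T) for measurable T ⊆ X). -/

import Mathlib

open MeasureTheory Set Filter

/-- `f : Z → ℝ` represents an element of `ℱ(Z)`: a measurable function with values in `[0,1]`. -/
def IsUF {Z : Type*} [MeasurableSpace Z] (f : Z → ℝ) : Prop :=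
  Measurable f ∧ ∀ z, f z ∈ Set.Icc (0 : ℝ) 1

/-- A functional `G : ℱ(Z) → [0,1]` is weakly averaging if it sends each constant
function with value `c ∈ [0,1]` to `c`. -/
def WeaklyAveraging {Z : Type*} [MeasurableSpace Z] (G : (Z → ℝ) → ℝ) : Prop :=
  ∀ c ∈ Set.Icc (0 : ℝ) 1, G (fun _ => c) = c

/-- A functional `G : ℱ(Z) → [0,1]` is affine if it preserves convex combinations
(taken pointwise). -/
def IsAffineFunctional {Z : Type*} [MeasurableSpace Z] (G : (Z → ℝ) → ℝ) : Prop :=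
  ∀ f g : Z → ℝ, IsUF f → IsUF g → ∀ α ∈ Set.Icc (0 : ℝ) 1,
    G (fun z => α * f z + (1 - α) * g z) = α * G f + (1 - α) * G g

/-- A functional `G : ℱ(Z) → [0,1]` preserves limits if on each `f ∈ ℱ(Z)` its value is
the supremum of its values on simple (finite range) members of `ℱ(Z)` below `f`. -/
def PreservesLimitsFunctional {Z : Type*} [MeasurableSpace Z] (G : (Z → ℝ) → ℝ) : Prop :=
  ∀ f : Z → ℝ, IsUF f →
    G f = sSup {r : ℝ | ∃ ψ : Z → ℝ,
      IsUF ψ ∧ (Set.range ψ).Finite ∧ (∀ z, ψ z ≤ f z) ∧ G ψ = r}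

theorem PreservesLimitsFunctional.mono {Z : Type*} [MeasurableSpace Z] {G : (Z → ℝ) → ℝ}
    (hG01 : ∀ f, IsUF f → G f ∈ Set.Icc (0 : ℝ) 1) (hPL : PreservesLimitsFunctional G)
    {f g : Z → ℝ} (hf : IsUF f) (hg : IsUF g) (hfg : ∀ z, f z ≤ g z) : G f ≤ G g := by
  rw [hPL f hf, hPL g hg]
  apply csSup_le_csSup
  · refine ⟨1, ?_⟩
    rintro _ ⟨ψ, hψ, -, -, rfl⟩
    exact (hG01 ψ hψ).2
  · refine ⟨_, fun _ => 0, ⟨measurable_const, fun _ => by simp⟩, ?_, fun z => (hf.2 z).1, rfl⟩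
    exact Set.finite_range_const
  · rintro _ ⟨ψ, hψ, hfin, hle, rfl⟩
    exact ⟨ψ, hψ, hfin, fun z => (hle z).trans (hfg z), rfl⟩

theorem IsUF.comp {X Y : Type*} [MeasurableSpace X] [MeasurableSpace Y] {g : Y → ℝ} {k : X → Y}
    (hg : IsUF g) (hk : Measurable k) : IsUF (g ∘ k) :=
  ⟨hg.1.comp hk, fun x => hg.2 (k x)⟩

theorem IsUF.convexComb {Z : Type*} [MeasurableSpace Z] {f g : Z → ℝ} (hf : IsUF f) (hg : IsUF g)
    {α : ℝ} (hα : α ∈ Set.Icc (0 : ℝ) 1) : IsUF fun z => α * f z + (1 - α) * g z :=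
  ⟨(hf.1.const_mul α).add (hg.1.const_mul (1 - α)), fun z =>
    convex_Icc (0 : ℝ) 1 (hf.2 z) (hg.2 z) hα.1 (sub_nonneg.2 hα.2) (by ring)⟩

/-- Every member of `ℱ(Z)` is uniformly approximated from below by simple members. -/
theorem IsUF.exists_simple_le {Z : Type*} [MeasurableSpace Z] {f : Z → ℝ} (hf : IsUF f)
    {n : ℕ} (hn : 0 < n) :
    ∃ ψ : Z → ℝ, IsUF ψ ∧ (Set.range ψ).Finite ∧ (∀ z, ψ z ≤ f z) ∧
      ∀ z, f z ≤ ψ z + 1 / n := by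
  have hn' : (0 : ℝ) < n := by exact_mod_cast hn
  have hle : ∀ z, (⌊n * f z⌋₊ : ℝ) / n ≤ f z := fun z => by
    rw [div_le_iff₀ hn', mul_comm (f z)]
    exact Nat.floor_le (mul_nonneg hn'.le (hf.2 z).1)
  refine ⟨fun z => (⌊n * f z⌋₊ : ℝ) / n, ⟨?_, fun z => ⟨by positivity, (hle z).trans (hf.2 z).2⟩⟩,
    ?_, hle, fun z => ?_⟩
  · have h : Measurable fun z => ⌊n * f z⌋₊ := Nat.measurable_floor.comp (hf.1.const_mul _)
    exact ((measurable_from_nat (f := fun m : ℕ => (m : ℝ))).comp h).div_const _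
  · refine ((Set.finite_Iic n).image fun m : ℕ => (m : ℝ) / n).subset ?_
    rintro _ ⟨z, rfl⟩
    refine ⟨_, Nat.floor_le_of_le ?_, rfl⟩
    exact mul_le_of_le_one_right hn'.le (hf.2 z).2
  · rw [← add_div, le_div_iff₀ hn', mul_comm]
    exact (Nat.lt_floor_add_one _).le

/-- A monotone, affine, weakly averaging functional changes by at most `1 / n` under a
uniform perturbation of size `1 / n`. -/
theorem IsAffineFunctional.le_add_one_div {Z : Type*} [MeasurableSpace Z] {G : (Z → ℝ) → ℝ}
    (hWA : WeaklyAveraging G) (hAff : IsAffineFunctional G)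
    (hmono : ∀ f g, IsUF f → IsUF g → (∀ z, f z ≤ g z) → G f ≤ G g)
    {f g : Z → ℝ} (hf : IsUF f) (hg : IsUF g) {n : ℕ} (hn : 0 < n)
    (hfg : ∀ z, f z ≤ g z + 1 / n) : G f ≤ G g + 1 / n := by
  have hn' : (0 : ℝ) < n := by exact_mod_cast hn
  have hα : (n / (n + 1) : ℝ) ∈ Set.Icc (0 : ℝ) 1 :=
    ⟨by positivity, (div_le_one (by positivity)).2 (by linarith)⟩
  have hα0 : (0 : ℝ) < n / (n + 1) := by positivity
  have hα1 : (1 - n / (n + 1) : ℝ) = n / (n + 1) * (1 / n) := by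
    field_simp
    ring
  have h0 : IsUF fun _ : Z => (0 : ℝ) := ⟨measurable_const, fun _ => by simp⟩
  have h1 : IsUF fun _ : Z => (1 : ℝ) := ⟨measurable_const, fun _ => by simp⟩
  have h := hmono _ _ (hf.convexComb h0 hα) (hg.convexComb h1 hα) fun z => by
    rw [hα1, mul_zero, add_zero, mul_one, ← mul_add]
    exact mul_le_mul_of_nonneg_left (hfg z) hα0.le
  rw [hAff f _ hf h0 _ hα, hAff g _ hg h1 _ hα, hWA 0 (by simp), hWA 1 (by simp), hα1,
    mul_zero, add_zero, mul_one, ← mul_add] at h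
  exact le_of_mul_le_mul_left h hα0

/-- for `k : X → Y` measurable and `G : ℱ(X) → [0,1]` weakly averaging,
affine and limit-preserving, the pushforward functional `g ↦ G(g ∘ k)` on `ℱ(Y)` is
weakly averaging, affine and limit-preserving, and its associated probability measure
`S ↦ G(χ_{k⁻¹(S)})` is the pushforward `ν_G ∘ k⁻¹` of the measure `ν_G : T ↦ G(χ_T)`. -/
theorem pushforward_functional_properties
    {X Y : Type*} [MeasurableSpace X] [MeasurableSpace Y]
    (k : X → Y) (hk : Measurable k)
    (G : (X → ℝ) → ℝ)
    (hG01 : ∀ f, IsUF f → G f ∈ Set.Icc (0 : ℝ) 1)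
    (hWA : WeaklyAveraging G) (hAff : IsAffineFunctional G)
    (hPL : PreservesLimitsFunctional G)
    (ν : Measure X) (hν : IsProbabilityMeasure ν)
    (hνG : ∀ T : Set X, MeasurableSet T →
      ν T = ENNReal.ofReal (G (T.indicator fun _ => (1 : ℝ)))) :
    WeaklyAveraging (fun g : Y → ℝ => G (g ∘ k)) ∧
    IsAffineFunctional (fun g : Y → ℝ => G (g ∘ k)) ∧
    PreservesLimitsFunctional (fun g : Y → ℝ => G (g ∘ k)) ∧
    ∀ S : Set Y, MeasurableSet S →
      ENNReal.ofReal (G ((k ⁻¹' S).indicator fun _ => (1 : ℝ))) = ν.map k S := by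
  refine ⟨fun c hc => hWA c hc,
    fun f g hf hg α hα => hAff _ _ (hf.comp hk) (hg.comp hk) α hα, fun f hf => ?_, fun S hS => ?_⟩
  · have hmono : ∀ f g, IsUF f → IsUF g → (∀ z, f z ≤ g z) → G f ≤ G g :=
      fun _ _ hf hg => hPL.mono hG01 hf hg
    apply le_antisymm
    · refine le_of_forall_pos_le_add fun ε hε => ?_
      obtain ⟨m, hm⟩ := exists_nat_one_div_lt hε
      obtain ⟨ψ, hψ, hfin, hle, hge⟩ := hf.exists_simple_le m.succ_pos
      have h := hAff.le_add_one_div hWA hmono (hf.comp hk) (hψ.comp hk) m.succ_pos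
        fun x => hge (k x)
      have hsup : G (ψ ∘ k) ≤ sSup {r : ℝ | ∃ ψ : Y → ℝ,
          IsUF ψ ∧ (Set.range ψ).Finite ∧ (∀ z, ψ z ≤ f z) ∧ G (ψ ∘ k) = r} := by
        refine le_csSup ⟨1, ?_⟩ ⟨ψ, hψ, hfin, hle, rfl⟩
        rintro _ ⟨φ, hφ, -, -, rfl⟩
        exact (hG01 _ (hφ.comp hk)).2
      push_cast at h
      exact h.trans (add_le_add hsup hm.le)
    · obtain ⟨ψ, hψ, hfin, hle, -⟩ := hf.exists_simple_le one_pos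
      refine csSup_le ⟨_, ψ, hψ, hfin, hle, rfl⟩ ?_
      rintro _ ⟨φ, hφ, -, hφf, rfl⟩
      exact hmono _ _ (hφ.comp hk) (hf.comp hk) fun x => hφf (k x)
  · rw [Measure.map_apply hk hS, hνG _ (hk hS)]
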